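/- arXiv:1805.09661 — 2 statements merged into one kernel-verified Lean document; each statement's English description precedes it below -/
import Mathlib

section
/- For every integer k ≥ 2 there exists an integer N (depending on k) such that for every connected simple graph G on n ≥ N vertices, the sum of the k largest distance eigenvalues satisfies S_k(D(G)) ≥ n − k, and equality S_k(D(G)) = n − k holds if and only if G is the complete graph K_n. -/
open Finset SimpleGraph

/-- The distance matrix of a simple graph on `Fin n`, as a real matrix: the
`(i,j)` entry is the graph distance `d_G(i,j)`. -/
noncomputable def distMatrix {n : ℕ} (G : SimpleGraph (Fin n)) :
    Matrix (Fin n) (Fin n) ℝ :=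
  fun i j => (G.dist i j : ℝ)

/-- The eigenvalues of the distance matrix, listed in decreasing order. -/
noncomputable def distEigList {n : ℕ} (G : SimpleGraph (Fin n)) : List ℝ :=
  if h : (distMatrix G).IsHermitian then
    (List.ofFn h.eigenvalues).insertionSort (· ≥ ·)
  else []

/-- `distEig G k` is the `k`-th largest distance eigenvalue `λ_k(D(G))` (`1`-indexed). -/
noncomputable def distEig {n : ℕ} (G : SimpleGraph (Fin n)) (k : ℕ) : ℝ :=
  (distEigList G).getD (k - 1) 0

/-- `S_k(D(G))`, the sum of the `k` largest distance eigenvalues. -/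
noncomputable def distEigSum {n : ℕ} (G : SimpleGraph (Fin n)) (k : ℕ) : ℝ :=
  ((distEigList G).take k).sum

/-- `G` has independence number at most `s`: every set of pairwise
nonadjacent vertices has at most `s` elements. -/
def IndepNumLE {V : Type*} (G : SimpleGraph V) (s : ℕ) : Prop :=
  ∀ S : Finset V, (∀ u ∈ S, ∀ v ∈ S, u ≠ v → ¬ G.Adj u v) → S.card ≤ s


theorem distMatrix_herm {n : ℕ} (G : SimpleGraph (Fin n)) : (distMatrix G).IsHermitian := by
  ext i j
  simp [distMatrix, SimpleGraph.dist_comm]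

theorem exists_spec {n : ℕ} (G : SimpleGraph (Fin n)) :
    ∃ μ : Fin n → ℝ, ∃ u : Fin n → Fin n → ℝ, Antitone μ ∧ distEigList G = List.ofFn μ ∧
      (∀ x : Fin n → ℝ, ∑ i, x i ^ 2 = ∑ j, (∑ i, u j i * x i) ^ 2) ∧
      (∀ x : Fin n → ℝ, ∑ i, ∑ j, (G.dist i j : ℝ) * x i * x j
        = ∑ j, μ j * (∑ i, u j i * x i) ^ 2) ∧
      (∑ j, μ j = 0) ∧ (∀ j l, ∑ i, u j i * u l i = if j = l then 1 else 0) := by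
  have h := distMatrix_herm G
  set σ := Tuple.sort (fun i => - h.eigenvalues i) with hσ
  have hmono : Monotone ((fun i => - h.eigenvalues i) ∘ σ) := Tuple.monotone_sort _
  have hanti : Antitone (h.eigenvalues ∘ σ) := by
    intro a b hab
    have := hmono hab
    simp only [Function.comp] at this ⊢
    linarith
  have horth : ∀ j l, ∑ i, h.eigenvectorBasis j i * h.eigenvectorBasis l i
      = if j = l then (1:ℝ) else 0 := by
    intro j l
    have := orthonormal_iff_ite.1 h.eigenvectorBasis.orthonormal j l
    rw [← this]
    simp [PiLp.inner_apply, mul_comm]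
  have hin : ∀ (x : Fin n → ℝ) j, inner ℝ (h.eigenvectorBasis j) (WithLp.toLp 2 x) =
      ∑ i, h.eigenvectorBasis j i * x i := by
    intro x j
    simp [PiLp.inner_apply, mul_comm]
  have hpars : ∀ x y : Fin n → ℝ, ∑ i, x i * y i = ∑ j, (∑ i, h.eigenvectorBasis j i * x i) *
      (∑ i, h.eigenvectorBasis j i * y i) := by
    intro x y
    have := h.eigenvectorBasis.sum_inner_mul_inner (WithLp.toLp 2 x) (WithLp.toLp 2 y)
    simp only [hin, real_inner_comm (h.eigenvectorBasis _) (WithLp.toLp 2 x)] at this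
    rw [this]
    simp [PiLp.inner_apply, mul_comm]
  have hmul : ∀ j i, ∑ l, (G.dist i l : ℝ) * h.eigenvectorBasis j l =
      h.eigenvalues j * h.eigenvectorBasis j i := by
    intro j i
    have := congrFun (h.mulVec_eigenvectorBasis j) i
    simpa [Matrix.mulVec, dotProduct, distMatrix] using this
  refine ⟨h.eigenvalues ∘ σ, fun j i => h.eigenvectorBasis (σ j) i, hanti, ?_, ?_, ?_, ?_, ?_⟩
  · rw [distEigList, dif_pos h]
    refine List.Perm.eq_of_pairwise' (r := (· ≥ ·)) (List.pairwise_insertionSort _ _) ?_ ?_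
    · rw [List.pairwise_ofFn]
      intro i j hij
      exact hanti hij.le
    · exact (List.perm_insertionSort _ _).trans (Equiv.Perm.ofFn_comp_perm σ _).symm
  · intro x
    rw [Equiv.sum_comp σ (fun j => (∑ i, h.eigenvectorBasis j i * x i) ^ 2)]
    simp only [sq]
    exact hpars x x
  · intro x
    rw [show ∑ j, (h.eigenvalues ∘ σ) j * (∑ i, h.eigenvectorBasis (σ j) i * x i) ^ 2 = _ from
      Equiv.sum_comp σ (fun j => h.eigenvalues j * (∑ i, h.eigenvectorBasis j i * x i) ^ 2)]
    have := hpars x (fun i => ∑ j, (G.dist i j : ℝ) * x j)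
    rw [show ∑ i, ∑ j, (G.dist i j : ℝ) * x i * x j = ∑ i, x i * ∑ j, (G.dist i j : ℝ) * x j by
      refine Finset.sum_congr rfl fun i _ => ?_
      rw [Finset.mul_sum]
      refine Finset.sum_congr rfl fun j _ => ?_
      ring]
    rw [this]
    refine Finset.sum_congr rfl fun j _ => ?_
    have : ∑ i, h.eigenvectorBasis j i * ∑ l, (G.dist i l : ℝ) * x l =
      h.eigenvalues j * ∑ i, h.eigenvectorBasis j i * x i := by
      simp only [Finset.mul_sum]
      rw [Finset.sum_comm]
      refine Finset.sum_congr rfl fun l _ => ?_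
      rw [← mul_assoc, ← hmul j l, Finset.sum_mul]
      refine Finset.sum_congr rfl fun i _ => ?_
      rw [SimpleGraph.dist_comm]; ring
    rw [this]; ring
  · rw [show ∑ j, (h.eigenvalues ∘ σ) j = _ from Equiv.sum_comp σ h.eigenvalues]
    have := h.trace_eq_sum_eigenvalues
    simp [Matrix.trace, distMatrix] at this
    exact this.symm
  · intro j l
    rw [horth]
    simp

theorem eig_lower {n : ℕ} (G : SimpleGraph (Fin n)) (μ : Fin n → ℝ) (u : Fin n → Fin n → ℝ)
    (hanti : Antitone μ)
    (h1 : ∀ x : Fin n → ℝ, ∑ i, x i ^ 2 = ∑ j, (∑ i, u j i * x i) ^ 2)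
    (h2 : ∀ x : Fin n → ℝ, ∑ i, ∑ j, (G.dist i j : ℝ) * x i * x j
        = ∑ j, μ j * (∑ i, u j i * x i) ^ 2)
    (s : Finset (Fin n)) (c : ℝ)
    (hs : ∀ x : Fin n → ℝ, (∀ i, i ∉ s → x i = 0) →
      -c * ∑ i, x i ^ 2 ≤ ∑ i, ∑ j, (G.dist i j : ℝ) * x i * x j)
    (j : Fin n) (hj : j.val < s.card) : -c ≤ μ j := by
  by_contra hlt
  push Not at hlt
  let E : (s → ℝ) →ₗ[ℝ] (Fin n → ℝ) := Function.ExtendByZero.linearMap ℝ (Subtype.val : s → Fin n)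
  let U : (Fin n → ℝ) →ₗ[ℝ] (Fin j.val → ℝ) :=
    Matrix.mulVecLin (fun (l : Fin j.val) i => u ⟨l.val, l.isLt.trans j.isLt⟩ i)
  have hker : LinearMap.ker (U ∘ₗ E) ≠ ⊥ := by
    apply LinearMap.ker_ne_bot_of_finrank_lt
    simpa using hj
  obtain ⟨x, hx, hx0⟩ := (Submodule.ne_bot_iff _).1 hker
  have hEinj : Function.Injective E := Function.extend_injective Subtype.val_injective _
  have hy0 : E x ≠ 0 := fun h => hx0 (hEinj (by rw [h, map_zero]))
  have hysupp : ∀ i, i ∉ s → E x i = 0 := by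
    intro i hi
    change Function.extend Subtype.val x 0 i = 0
    rw [Function.extend_apply']
    · rfl
    · rintro ⟨a, rfl⟩
      exact hi a.2
  have hU : U (E x) = 0 := by simpa using hx
  generalize E x = y at *
  have hz : ∀ l : Fin n, l < j → ∑ i, u l i * y i = 0 := by
    intro l hl
    exact congrFun hU ⟨l.val, hl⟩
  have hpos : 0 < ∑ i, y i ^ 2 := by
    obtain ⟨i, hi⟩ := Function.ne_iff.1 hy0
    exact Finset.sum_pos' (fun i _ => sq_nonneg _) ⟨i, Finset.mem_univ _, by
      have : y i ≠ 0 := hi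
      positivity⟩
  have := hs y hysupp
  have hle : ∑ l, μ l * (∑ i, u l i * y i) ^ 2 ≤ μ j * ∑ l, (∑ i, u l i * y i) ^ 2 := by
    rw [Finset.mul_sum]
    refine Finset.sum_le_sum fun l _ => ?_
    by_cases hl : l < j
    · simp [hz l hl]
    · exact mul_le_mul_of_nonneg_right (hanti (not_lt.1 hl)) (sq_nonneg _)
  rw [h2] at this
  rw [← h1] at hle
  nlinarith

theorem sum_sq_supp {n : ℕ} (s : Finset (Fin n)) (x : Fin n → ℝ) (hx : ∀ i, i ∉ s → x i = 0)
    (f : Fin n → ℝ) : ∑ i, f i * x i = ∑ i ∈ s, f i * x i := by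
  symm
  apply Finset.sum_subset (Finset.subset_univ _)
  intro i _ hi
  rw [hx i hi, mul_zero]

theorem clique_form {n : ℕ} (G : SimpleGraph (Fin n)) (s : Finset (Fin n)) (hs : G.IsClique s)
    (x : Fin n → ℝ) (hx : ∀ i, i ∉ s → x i = 0) :
    -1 * ∑ i, x i ^ 2 ≤ ∑ i, ∑ j, (G.dist i j : ℝ) * x i * x j := by
  have : ∑ i, ∑ j, (G.dist i j : ℝ) * x i * x j = (∑ i, x i) ^ 2 - ∑ i, x i ^ 2 := by
    rw [sq, Finset.sum_mul_sum, ← Finset.sum_sub_distrib]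
    refine Finset.sum_congr rfl fun i _ => ?_
    have : x i ^ 2 = ∑ j, if i = j then x i * x j else 0 := by simp [sq]
    rw [this, ← Finset.sum_sub_distrib]
    refine Finset.sum_congr rfl fun j _ => ?_
    by_cases hij : i = j
    · subst hij; simp
    · by_cases hi : i ∈ s
      · by_cases hj : j ∈ s
        · have : G.dist i j = 1 := SimpleGraph.dist_eq_one_iff_adj.2 (hs hi hj hij)
          simp [this, hij]
        · simp [hx j hj]
      · simp [hx i hi]
  rw [this]
  nlinarith [sq_nonneg (∑ i, x i)]

theorem bdd_form {n : ℕ} (G : SimpleGraph (Fin n)) (s : Finset (Fin n)) (d : ℕ)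
    (hs : ∀ i ∈ s, ∀ j ∈ s, G.dist i j ≤ d)
    (x : Fin n → ℝ) (hx : ∀ i, i ∉ s → x i = 0) :
    -((d : ℝ) * s.card) * ∑ i, x i ^ 2 ≤ ∑ i, ∑ j, (G.dist i j : ℝ) * x i * x j := by
  have e1 : ∑ i, x i ^ 2 = ∑ i ∈ s, x i ^ 2 := by
    symm
    apply Finset.sum_subset (Finset.subset_univ _)
    intro i _ hi
    rw [hx i hi]; simp
  have e2 : ∑ i, ∑ j, (G.dist i j : ℝ) * x i * x j =
      ∑ i ∈ s, ∑ j ∈ s, (G.dist i j : ℝ) * x i * x j := by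
    symm
    rw [← Finset.sum_subset (Finset.subset_univ s)]
    · refine Finset.sum_congr rfl fun i _ => ?_
      apply Finset.sum_subset (Finset.subset_univ _)
      intro j _ hj
      rw [hx j hj]; simp
    · intro i _ hi
      simp [hx i hi]
  have e3 : -((d : ℝ) * s.card) * ∑ i ∈ s, x i ^ 2 =
      ∑ i ∈ s, ∑ j ∈ s, (-(d : ℝ) / 2 * (x i ^ 2 + x j ^ 2)) := by
    simp only [← Finset.mul_sum, Finset.sum_add_distrib, Finset.sum_const, nsmul_eq_mul]
    ring
  rw [e1, e2, e3]
  refine Finset.sum_le_sum fun i hi => Finset.sum_le_sum fun j hj => ?_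
  have h0 : (0 : ℝ) ≤ G.dist i j := by positivity
  have h1 : (G.dist i j : ℝ) ≤ d := by exact_mod_cast hs i hi j hj
  nlinarith [mul_nonneg h0 (sq_nonneg (x i + x j)),
    mul_nonneg (sub_nonneg.2 h1) (add_nonneg (sq_nonneg (x i)) (sq_nonneg (x j)))]

theorem exists_near {n : ℕ} (G : SimpleGraph (Fin n)) (hG : G.Connected) (v : Fin n) (k : ℕ)
    (hk : k + 1 ≤ n) :
    ∃ s : Finset (Fin n), s.card = k + 1 ∧ v ∈ s ∧ ∀ i ∈ s, G.dist v i ≤ k := by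
  induction k with
  | zero => exact ⟨{v}, by simp⟩
  | succ k ih =>
    obtain ⟨s, hc, hv, hs⟩ := ih (by omega)
    have : ∃ w, w ∉ s := by
      by_contra! h
      have : s = Finset.univ := Finset.eq_univ_iff_forall.2 h
      rw [this, Finset.card_univ, Fintype.card_fin] at hc
      omega
    obtain ⟨w, hw⟩ := this
    obtain ⟨p⟩ := hG.preconnected v w
    obtain ⟨e, -, he1, he2⟩ := p.exists_boundary_dart (s : Set (Fin n)) hv hw
    have he1 : e.fst ∈ s := he1
    have he2 : e.snd ∉ s := he2
    refine ⟨insert e.snd s, ?_, Finset.mem_insert_of_mem hv, ?_⟩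
    · rw [Finset.card_insert_of_notMem he2, hc]
    · intro i hi
      rcases Finset.mem_insert.1 hi with rfl | hi
      · have a := hG.dist_triangle (u := v) (v := e.fst) (w := e.snd)
        have b := SimpleGraph.dist_eq_one_iff_adj.2 e.adj
        have c := hs _ he1
        omega
      · exact (hs i hi).trans (by omega)

theorem turan_bound {n r : ℕ} (hr : 0 < r) (G : SimpleGraph (Fin n)) [DecidableRel G.Adj]
    (cf : G.CliqueFree (r + 1)) : 2 * r * #G.edgeFinset ≤ (r - 1) * n ^ 2 := by
  obtain ⟨H, _, maxH⟩ := exists_isTuranMaximal (V := Fin n) hr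
  have h1 : #G.edgeFinset ≤ #H.edgeFinset := by convert! maxH.2 cf
  have h2 : #H.edgeFinset = #(turanGraph n r).edgeFinset := by
    rw [((isTuranMaximal_iff_nonempty_iso_turanGraph hr).mp maxH).some.card_edgeFinset_eq]
    congr! <;> simp
  calc _ ≤ 2 * r * #(turanGraph n r).edgeFinset := by rw [← h2]; gcongr
    _ ≤ _ := mul_card_edgeFinset_turanGraph_le

theorem top_eig {n : ℕ} (G : SimpleGraph (Fin n)) (μ : Fin n → ℝ) (u : Fin n → Fin n → ℝ)
    (hanti : Antitone μ)
    (h1 : ∀ x : Fin n → ℝ, ∑ i, x i ^ 2 = ∑ j, (∑ i, u j i * x i) ^ 2)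
    (h2 : ∀ x : Fin n → ℝ, ∑ i, ∑ j, (G.dist i j : ℝ) * x i * x j
        = ∑ j, μ j * (∑ i, u j i * x i) ^ 2) (hn : 0 < n) :
    ∑ i, ∑ j, (G.dist i j : ℝ) ≤ μ ⟨0, hn⟩ * n := by
  have a := h1 (fun _ => 1)
  have b := h2 (fun _ => 1)
  simp only [mul_one] at a b
  simp at a
  rw [b, a, Finset.mul_sum]
  refine Finset.sum_le_sum fun l _ => ?_
  exact mul_le_mul_of_nonneg_right (hanti (Fin.mk_le_of_le_val (Nat.zero_le _))) (sq_nonneg _)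

theorem dist_sum_ge {n : ℕ} (G : SimpleGraph (Fin n)) (hG : G.Connected) :
    (n : ℝ) * (n - 1) ≤ ∑ i, ∑ j, (G.dist i j : ℝ) ∧
    (G ≠ ⊤ → (n : ℝ) * (n - 1) < ∑ i, ∑ j, (G.dist i j : ℝ)) := by
  have e : (n : ℝ) * (n - 1) = ∑ i : Fin n, ∑ j : Fin n, (1 - if i = j then (1:ℝ) else 0) := by
    simp
    ring
  have hle : ∀ i j, (1 - if i = j then (1:ℝ) else 0) ≤ (G.dist i j : ℝ) := by
    intro i j
    by_cases hij : i = j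
    · simp [hij]
    · have : 1 ≤ G.dist i j := hG.pos_dist_of_ne hij
      simp only [hij, if_false, sub_zero]
      exact_mod_cast this
  rw [e]
  refine ⟨Finset.sum_le_sum fun i _ => Finset.sum_le_sum fun j _ => hle i j, fun hne => ?_⟩
  have : ∃ i j, i ≠ j ∧ ¬ G.Adj i j := by
    by_contra! h
    apply hne
    ext i j
    simp only [top_adj]
    exact ⟨fun h => h.ne, h i j⟩
  obtain ⟨i, j, hij, ha⟩ := this
  refine Finset.sum_lt_sum (fun i _ => Finset.sum_le_sum fun j _ => hle i j)
    ⟨i, Finset.mem_univ _, Finset.sum_lt_sum (fun j _ => hle i j) ⟨j, Finset.mem_univ _, ?_⟩⟩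
  have h1 : 1 ≤ G.dist i j := hG.pos_dist_of_ne hij
  have h2 : G.dist i j ≠ 1 := fun h => ha (SimpleGraph.dist_eq_one_iff_adj.1 h)
  simp only [hij, if_false, sub_zero]
  exact_mod_cast (by omega : 1 < G.dist i j)

theorem dist_sum_ge' {n : ℕ} (G : SimpleGraph (Fin n)) (hG : G.Connected) [DecidableRel G.Adj] :
    2 * (n : ℝ) ^ 2 - 2 * n - 2 * #G.edgeFinset ≤ ∑ i, ∑ j, (G.dist i j : ℝ) := by
  have e : 2 * (n : ℝ) ^ 2 - 2 * n - 2 * #G.edgeFinset = ∑ i : Fin n, ∑ j : Fin n,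
      (2 - (if i = j then (2:ℝ) else 0) - if G.Adj i j then (1 : ℝ) else 0) := by
    have := G.sum_degrees_eq_twice_card_edges
    have h : ∑ i : Fin n, ∑ j : Fin n, (if G.Adj i j then (1 : ℝ) else 0) = 2 * #G.edgeFinset := by
      rw [← Nat.cast_ofNat, ← Nat.cast_mul, ← this]
      push_cast
      refine Finset.sum_congr rfl fun i _ => ?_
      rw [Finset.sum_boole]
      congr 2
      ext j; simp
    simp only [Finset.sum_sub_distrib, h]
    simp
    ring
  rw [e]
  refine Finset.sum_le_sum fun i _ => Finset.sum_le_sum fun j _ => ?_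
  by_cases hij : i = j
  · subst hij; simp
  · have h1 : 1 ≤ G.dist i j := hG.pos_dist_of_ne hij
    by_cases ha : G.Adj i j
    · simp only [hij, ha, if_false, if_true]
      have : (1 : ℝ) ≤ G.dist i j := by exact_mod_cast h1
      linarith
    · have h2 : G.dist i j ≠ 1 := fun h => ha (SimpleGraph.dist_eq_one_iff_adj.1 h)
      have : (2 : ℝ) ≤ G.dist i j := by exact_mod_cast (by omega : 2 ≤ G.dist i j)
      simp only [hij, ha, if_false]
      linarith

theorem sum_ge {n k : ℕ} (G : SimpleGraph (Fin n)) (μ : Fin n → ℝ)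
    (hl : distEigList G = List.ofFn μ) (hk : 0 < k) (hkn : k ≤ n) (c : ℝ)
    (hc : ∀ j : Fin n, j.val < k → -c ≤ μ j) :
    μ ⟨0, hk.trans_le hkn⟩ - (k - 1) * c ≤ distEigSum G k := by
  rw [distEigSum, hl, List.sum_take_ofFn]
  set S : Finset (Fin n) := Finset.univ.filter (fun j => j.val < k) with hS
  have hcard : S.card = k := by
    rw [hS, Fin.card_filter_val_lt]; omega
  have h0 : (⟨0, hk.trans_le hkn⟩ : Fin n) ∈ S := by simp [hS, hk]
  rw [← Finset.add_sum_erase S _ h0]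
  have : ((S.erase ⟨0, hk.trans_le hkn⟩).card : ℝ) * (-c) ≤
      ∑ x ∈ S.erase ⟨0, hk.trans_le hkn⟩, μ x := by
    rw [← nsmul_eq_mul]
    apply Finset.card_nsmul_le_sum
    intro x hx
    have := Finset.mem_of_mem_erase hx
    simp [hS] at this
    exact hc x this
  rw [Finset.card_erase_of_mem h0, hcard, Nat.cast_sub hk] at this
  push_cast at this
  linarith

theorem sum_k_largest_distance_eigenvalues_lower_bound :
    ∀ k : ℕ, 2 ≤ k → ∃ N : ℕ, ∀ n : ℕ, N ≤ n →
      ∀ G : SimpleGraph (Fin n), G.Connected →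
        distEigSum G k ≥ (n : ℝ) - k ∧
        (distEigSum G k = (n : ℝ) - k ↔ G = ⊤) := by
  intro k hk
  refine ⟨k + (k - 1) * (2 + (k - 1) * (2 * k * k)), fun n hn G hG => ?_⟩
  classical
  have hkn : k ≤ n := by omega
  have hk0 : 0 < k := by omega
  have hn0 : 0 < n := by omega
  have hn0' : (0 : ℝ) < n := by exact_mod_cast hn0
  obtain ⟨μ, u, hanti, hl, h1, h2, htr, horth⟩ := exists_spec G
  have htop := top_eig G μ u hanti h1 h2 hn0
  suffices H : (G = ⊤ → distEigSum G k = (n : ℝ) - k) ∧ (G ≠ ⊤ → (n : ℝ) - k < distEigSum G k) by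
    by_cases hG' : G = ⊤
    · exact ⟨(H.1 hG').ge, fun _ => hG', H.1⟩
    · exact ⟨(H.2 hG').le, fun h => absurd h (H.2 hG').ne', H.1⟩
  by_cases hcl : G.CliqueFree k
  ·
    have hnt : G ≠ ⊤ := by
      rintro rfl
      obtain ⟨t, -, ht⟩ := Finset.exists_subset_card_eq
        (s := (Finset.univ : Finset (Fin n))) (n := k) (by simpa using hkn)
      exact hcl t ⟨fun a _ b _ hab => hab, ht⟩
    refine ⟨fun h => absurd h hnt, fun _ => ?_⟩
    obtain ⟨r, rfl⟩ : ∃ r, k = r + 1 := ⟨k - 1, by omega⟩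
    have hr : 0 < r := by omega
    have hT := turan_bound hr G hcl
    have hT' : 2 * (r : ℝ) * #G.edgeFinset ≤ (r - 1) * (n : ℝ) ^ 2 := by
      have : ((2 * r * #G.edgeFinset : ℕ) : ℝ) ≤ (((r - 1) * n ^ 2 : ℕ) : ℝ) := by exact_mod_cast hT
      rw [Nat.cast_mul (r - 1), Nat.cast_sub (by omega : 1 ≤ r)] at this
      push_cast at this
      exact this
    obtain ⟨s, hsc, -, hs⟩ := exists_near G hG ⟨0, hn0⟩ r hkn
    have hlow := eig_lower G μ u hanti h1 h2 s _ (bdd_form G s (2 * r) (fun i hi j hj => by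
      have := hG.dist_triangle (u := i) (v := ⟨0, hn0⟩) (w := j)
      have a := hs i hi
      have b := hs j hj
      rw [SimpleGraph.dist_comm] at a
      omega))
    rw [hsc] at hlow
    have hsum := sum_ge G μ hl hk0 hkn _ hlow
    have hd := (dist_sum_ge' G hG).trans htop
    have hr' : (1 : ℝ) ≤ r := by exact_mod_cast hr
    have hn' : (r : ℝ) * (2 + r * (2 * (r + 1) * (r + 1))) ≤ n := by
      have : r * (2 + r * (2 * (r + 1) * (r + 1))) ≤ n := by
        simp only [Nat.add_sub_cancel] at hn
        omega
      exact_mod_cast this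
    set m := μ ⟨0, hn0⟩
    have h3 : (n : ℝ) * (r * n + n - 2 * r) ≤ n * (r * m) := by nlinarith
    have h4 := le_of_mul_le_mul_left h3 hn0'
    have h5 : (r : ℝ) * (n + r * (2 * (r + 1) * (r + 1))) ≤ r * m := by nlinarith
    have h6 := le_of_mul_le_mul_left h5 (by linarith)
    push_cast at hsum ⊢
    have h7 : (0 : ℝ) ≤ r * r * (r + 1) := by positivity
    nlinarith
  · rw [SimpleGraph.CliqueFree] at hcl
    push Not at hcl
    obtain ⟨s, hs⟩ := hcl
    have hlow := eig_lower G μ u hanti h1 h2 s 1 (clique_form G s hs.isClique)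
    rw [hs.card_eq] at hlow
    have hsum := sum_ge G μ hl hk0 hkn _ hlow
    have hd := dist_sum_ge G hG
    constructor
    · intro hT
      apply le_antisymm
      · have hall := eig_lower G μ u hanti h1 h2 Finset.univ 1 (clique_form G _ (by
          rw [hT]; intro a _ b _ hab; exact hab))
        rw [distEigSum, hl, List.sum_take_ofFn]
        have hsplit := Finset.sum_filter_add_sum_filter_not Finset.univ
          (fun j : Fin n => j.val < k) μ
        have hcard := Finset.card_filter_add_card_filter_not (s := (Finset.univ : Finset (Fin n)))
          (fun j : Fin n => j.val < k)
        rw [Fin.card_filter_val_lt, Finset.card_univ, Fintype.card_fin, min_eq_right hkn] at hcard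
        have := Finset.card_nsmul_le_sum (Finset.univ.filter (fun j : Fin n => ¬ j.val < k)) μ (-1)
          (fun x _ => hall x (by simp))
        rw [nsmul_eq_mul] at this
        have hc' : (k : ℝ) + #(Finset.univ.filter (fun j : Fin n => ¬ j.val < k)) = n := by
          exact_mod_cast hcard
        linarith
      · have : (n : ℝ) * (n - 1) ≤ n * μ ⟨0, hn0⟩ := by linarith [hd.1]
        have := le_of_mul_le_mul_left this hn0'
        linarith
    · intro hT
      have : (n : ℝ) * (n - 1) < n * μ ⟨0, hn0⟩ := by linarith [hd.2 hT]
      have := lt_of_mul_lt_mul_left this hn0'.le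
      linarith
end

section
/- Let s ≥ 2 be an integer and let G be a connected simple graph on n vertices with n > s³ + s² − 2s + 1, m edges, and independence number α(G) ≤ s. Then λ₂(D(G)) < 3s³ · t(G)/m, where t(G) is the number of triangles in G. -/
open Finset SimpleGraph

/-- Turán-type bound on a subset. -/
lemma turan_aux {V : Type*} [DecidableEq V] (G : SimpleGraph V) [DecidableRel G.Adj] :
    ∀ (s : ℕ) (A : Finset V),
      (∀ S ⊆ A, (∀ u ∈ S, ∀ v ∈ S, u ≠ v → ¬ G.Adj u v) → S.card ≤ s) →
      ((A.card : ℝ)) ^ 2 ≤ s * (∑ u ∈ A, ((((A.filter (G.Adj u)).card : ℕ) : ℝ) + 1)) := by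
  intro s
  induction s with
  | zero =>
    intro A h
    have hA : A = ∅ := by
      by_contra hne
      obtain ⟨v, hv⟩ := Finset.nonempty_iff_ne_empty.mpr hne
      have := h {v} (by simpa using hv) (by simp)
      simp at this
    subst hA
    simp
  | succ s ih =>
    intro A h
    rcases A.eq_empty_or_nonempty with rfl | hne
    · simp
    obtain ⟨v, hv, hmin⟩ := Finset.exists_min_image A (fun u => (A.filter (G.Adj u)).card) hne
    set C : Finset V := insert v (A.filter (G.Adj v)) with hC
    have hCA : C ⊆ A := by
      intro x hx
      simp only [hC, Finset.mem_insert, Finset.mem_filter] at hx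
      rcases hx with rfl | hx
      · exact hv
      · exact hx.1
    have hCcard : C.card = (A.filter (G.Adj v)).card + 1 := by
      rw [hC, Finset.card_insert_of_notMem]
      simp
    have hB := ih (A \ C) (by
      intro S hS hind
      have hvS : v ∉ S := fun hvS => by
        have := hS hvS
        simp [hC] at this
      have hnadj : ∀ u ∈ S, ¬ G.Adj v u := by
        intro u hu hadj
        have := hS hu
        simp only [hC, Finset.mem_sdiff, Finset.mem_insert, Finset.mem_filter] at this
        exact this.2 (Or.inr ⟨this.1, hadj⟩)
      have h1 := h (insert v S) (by
        intro x hx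
        rcases Finset.mem_insert.mp hx with rfl | hx
        · exact hv
        · exact (Finset.mem_sdiff.mp (hS hx)).1) (by
        intro a ha b hb hab
        rcases Finset.mem_insert.mp ha with ha1 | ha1
        · rcases Finset.mem_insert.mp hb with hb1 | hb1
          · exact absurd (ha1.trans hb1.symm) hab
          · rw [ha1]; exact hnadj b hb1
        · rcases Finset.mem_insert.mp hb with hb1 | hb1
          · rw [hb1]; exact fun hh => hnadj a ha1 hh.symm
          · exact hind a ha1 b hb1 hab)
      rw [Finset.card_insert_of_notMem hvS] at h1
      omega)
    have hsplit := Finset.sum_sdiff (f := fun u => ((((A.filter (G.Adj u)).card : ℕ) : ℝ) + 1)) hCA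
    have hc := Finset.card_sdiff_add_card_eq_card hCA
    have hle1 : ∑ u ∈ A \ C, (((((A \ C).filter (G.Adj u)).card : ℕ) : ℝ) + 1)
        ≤ ∑ u ∈ A \ C, ((((A.filter (G.Adj u)).card : ℕ) : ℝ) + 1) := by
      apply Finset.sum_le_sum
      intro u _
      have : ((A \ C).filter (G.Adj u)).card ≤ (A.filter (G.Adj u)).card :=
        Finset.card_le_card (Finset.filter_subset_filter _ Finset.sdiff_subset)
      have : (((A \ C).filter (G.Adj u)).card : ℝ) ≤ (A.filter (G.Adj u)).card := by
        exact_mod_cast this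
      linarith
    have hle2 : (C.card : ℝ) * C.card ≤ ∑ u ∈ C, ((((A.filter (G.Adj u)).card : ℕ) : ℝ) + 1) := by
      have := Finset.card_nsmul_le_sum C
        (fun u => ((((A.filter (G.Adj u)).card : ℕ) : ℝ) + 1)) (C.card : ℝ) (by
          intro u hu
          have := hmin u (hCA hu)
          rw [hCcard]
          exact_mod_cast Nat.succ_le_succ this)
      simpa using this
    have hcR : ((A.card : ℕ) : ℝ) = (A \ C).card + C.card := by exact_mod_cast hc.symm
    rw [← hsplit, hcR]
    push_cast
    set b : ℝ := ((A \ C).card : ℝ)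
    set k : ℝ := (C.card : ℝ)
    set X := ∑ u ∈ A \ C, ((((A.filter (G.Adj u)).card : ℕ) : ℝ) + 1)
    set Y := ∑ u ∈ C, ((((A.filter (G.Adj u)).card : ℕ) : ℝ) + 1)
    have hs0 : (0 : ℝ) ≤ s := Nat.cast_nonneg s
    have hX : b ^ 2 ≤ s * X := hB.trans (mul_le_mul_of_nonneg_left hle1 hs0)
    have hXb : b ≤ X := by
      have := Finset.card_nsmul_le_sum (A \ C)
        (fun u => ((((A.filter (G.Adj u)).card : ℕ) : ℝ) + 1)) 1 (by intro u _; simp)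
      simpa using this
    have hb0 : 0 ≤ b := Nat.cast_nonneg _
    rcases hs0.eq_or_lt with h0 | hpos
    · rw [← h0] at hX ⊢
      have : b = 0 := by nlinarith
      rw [this] at hXb ⊢
      nlinarith
    · have h1 : 0 ≤ (s * k - b) ^ 2 := sq_nonneg _
      have h2 : s * (b + k) ^ 2 ≤ s * ((s + 1) * (X + Y)) := by
        nlinarith [mul_le_mul_of_nonneg_left hle2 (by positivity : (0 : ℝ) ≤ s * (s + 1)),
          mul_le_mul_of_nonneg_left hX (by positivity : (0 : ℝ) ≤ (s + 1))]
      exact le_of_mul_le_mul_left h2 hpos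

lemma dist_bound {n s : ℕ} (G : SimpleGraph (Fin n)) (hG : G.Connected) (hα : IndepNumLE G s)
    (u v : Fin n) : G.dist u v + 1 ≤ 2 * s := by
  obtain ⟨p, hp⟩ := hG.exists_walk_length_eq_dist u v
  have hk : ∀ k ≤ G.dist u v, G.dist u (p.getVert k) = k := by
    intro k hk
    have h1 : G.dist u (p.getVert k) ≤ k := (SimpleGraph.dist_le (p.take k)).trans (by
      rw [SimpleGraph.Walk.take_length]; omega)
    have h2 : G.dist (p.getVert k) v ≤ p.length - k :=
      (SimpleGraph.dist_le (p.drop k)).trans (by rw [SimpleGraph.Walk.drop_length])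
    have h3 := hG.dist_triangle (u := u) (v := p.getVert k) (w := v)
    omega
  have h := hα ((Finset.range (G.dist u v / 2 + 1)).image (fun i => p.getVert (2 * i))) (by
    intro a ha b hb hab hadj
    obtain ⟨i, hi, rfl⟩ := Finset.mem_image.mp ha
    obtain ⟨j, hj, rfl⟩ := Finset.mem_image.mp hb
    rw [Finset.mem_range] at hi hj
    have hij : i ≠ j := by rintro rfl; exact hab rfl
    have e1 := hk (2 * i) (by omega)
    have e2 := hk (2 * j) (by omega)
    have h3 := hG.dist_triangle (u := u) (v := p.getVert (2 * i)) (w := p.getVert (2 * j))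
    have h4 := hG.dist_triangle (u := u) (v := p.getVert (2 * j)) (w := p.getVert (2 * i))
    rw [SimpleGraph.dist_eq_one_iff_adj.mpr hadj] at h3
    rw [SimpleGraph.dist_eq_one_iff_adj.mpr hadj.symm] at h4
    omega)
  rw [Finset.card_image_of_injOn, Finset.card_range] at h
  · omega
  · intro i hi j hj hij
    simp only [Finset.coe_range, Set.mem_Iio] at hi hj
    have e1 := hk (2 * i) (by omega)
    have e2 := hk (2 * j) (by omega)
    simp only at hij
    rw [hij] at e1
    omega

lemma quad_bound {n s : ℕ} (G : SimpleGraph (Fin n)) (hG : G.Connected) (hα : IndepNumLE G s)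
    (x : Fin n → ℝ) (hx : ∑ i, x i = 0) :
    ∑ i, x i * ((distMatrix G).mulVec x) i ≤ (((s : ℝ) - 1) * n - (2 * s - 1)) * ∑ i, x i ^ 2 := by
  have key : ∀ i j, (distMatrix G i j - s) * (x i * x j) ≤
      ((s : ℝ) - 1) * (x i ^ 2 + x j ^ 2) / 2 - (if i = j then (2 * (s : ℝ) - 1) * x i ^ 2 else 0) := by
    intro i j
    split_ifs with hij
    · subst hij
      simp only [distMatrix, SimpleGraph.dist_self]
      push_cast
      nlinarith
    · have h1 : (1 : ℝ) ≤ distMatrix G i j := by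
        have := hG.pos_dist_of_ne hij
        simp only [distMatrix]
        exact_mod_cast this
      have h2 : distMatrix G i j + 1 ≤ 2 * s := by
        have := dist_bound G hG hα i j
        simp only [distMatrix]
        exact_mod_cast this
      nlinarith [mul_nonneg (by linarith : 0 ≤ distMatrix G i j - 1) (sq_nonneg (x i - x j)),
        mul_nonneg (by linarith : 0 ≤ 2 * s - 1 - distMatrix G i j) (sq_nonneg (x i + x j))]
  have hsum := Finset.sum_le_sum (s := Finset.univ) (fun i (_ : i ∈ Finset.univ) =>
    Finset.sum_le_sum (s := Finset.univ) (fun j (_ : j ∈ Finset.univ) => key i j))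
  have hL : ∑ i, ∑ j, (distMatrix G i j - s) * (x i * x j)
      = ∑ i, x i * ((distMatrix G).mulVec x) i := by
    apply Finset.sum_congr rfl
    intro i _
    have : ∀ j, (distMatrix G i j - s) * (x i * x j)
      = x i * (distMatrix G i j * x j) - (s * x i) * x j := by intro j; ring
    simp only [this, Finset.sum_sub_distrib, ← Finset.mul_sum, hx, Matrix.mulVec, dotProduct]
    ring
  have hR : ∑ i, ∑ j, (((s : ℝ) - 1) * (x i ^ 2 + x j ^ 2) / 2
      - (if i = j then (2 * (s : ℝ) - 1) * x i ^ 2 else 0))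
      = (((s : ℝ) - 1) * n - (2 * s - 1)) * ∑ i, x i ^ 2 := by
    simp only [Finset.sum_sub_distrib, ← Finset.sum_div, ← Finset.mul_sum, Finset.sum_add_distrib,
      Finset.sum_const, Finset.card_univ, Fintype.card_fin, Finset.sum_ite_eq, Finset.mem_univ,
      if_true, nsmul_eq_mul]
    ring
  rw [hL, hR] at hsum
  exact hsum

lemma eig_bound {n : ℕ} (G : SimpleGraph (Fin n)) (hn : 2 ≤ n) (c : ℝ)
    (hq : ∀ x : Fin n → ℝ, ∑ i, x i = 0 →
      ∑ i, x i * ((distMatrix G).mulVec x) i ≤ c * ∑ i, x i ^ 2) : distEig G 2 ≤ c := by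
  have h : (distMatrix G).IsHermitian := by
    ext i j
    simp [distMatrix, SimpleGraph.dist_comm]
  by_contra hlt
  push Not at hlt
  unfold distEig distEigList at hlt
  rw [dif_pos h] at hlt
  set l := (List.ofFn h.eigenvalues).insertionSort (· ≥ ·) with hl
  have hperm : l.Perm (List.ofFn h.eigenvalues) := List.perm_insertionSort _ _
  have hsorted : l.Pairwise (· ≥ ·) := List.pairwise_insertionSort _ _
  have hlen : l.length = n := by rw [hperm.length_eq, List.length_ofFn]
  obtain ⟨i, j, hij, hi, hj⟩ : ∃ i j, i ≠ j ∧ c < h.eigenvalues i ∧ c < h.eigenvalues j := by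
    by_contra hcon
    push Not at hcon
    have hcount : l.countP (fun a => decide (c < a)) ≤ 1 := by
      rw [hperm.countP_eq, List.ofFn_eq_map, List.countP_map, List.countP_eq_length_filter,
        ← List.toFinset_card_of_nodup ((List.nodup_finRange n).filter _)]
      rw [Finset.card_le_one]
      intro a ha b hb
      simp at ha hb
      by_contra hab
      exact absurd hb (not_lt.mpr (hcon a b hab ha))
    match l, hlen, hsorted, hlt, hcount with
    | [], hlen, _, _, _ => simp at hlen; omega
    | [a], hlen, _, _, _ => simp at hlen; omega
    | a :: b :: t, _, hs, hlt, hcount =>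
      simp at hlt hs
      have : c < a := lt_of_lt_of_le hlt hs.1.1
      simp [List.countP_cons, hlt, this] at hcount
  set v : Fin n → ℝ := ⇑(h.eigenvectorBasis i)
  set w : Fin n → ℝ := ⇑(h.eigenvectorBasis j)
  have hv : (distMatrix G).mulVec v = h.eigenvalues i • v := h.mulVec_eigenvectorBasis i
  have hw : (distMatrix G).mulVec w = h.eigenvalues j • w := h.mulVec_eigenvectorBasis j
  have hon := h.eigenvectorBasis.orthonormal
  rw [orthonormal_iff_ite] at hon
  have hvv : ∑ k, v k * v k = 1 := by
    have := hon i i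
    rw [PiLp.inner_apply, if_pos rfl] at this
    simpa only [RCLike.inner_apply, conj_trivial] using this
  have hww : ∑ k, w k * w k = 1 := by
    have := hon j j
    rw [PiLp.inner_apply, if_pos rfl] at this
    simpa only [RCLike.inner_apply, conj_trivial] using this
  have hvw : ∑ k, v k * w k = 0 := by
    have := hon j i
    rw [PiLp.inner_apply, if_neg hij.symm] at this
    simpa only [RCLike.inner_apply, conj_trivial] using this
  have main : ∀ p q : ℝ, p * ∑ k, v k + q * ∑ k, w k = 0 →
      p ^ 2 * h.eigenvalues i + q ^ 2 * h.eigenvalues j ≤ c * (p ^ 2 + q ^ 2) := by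
    intro p q hpq
    have h1 := hq (p • v + q • w) (by
      simpa [Finset.sum_add_distrib, ← Finset.mul_sum] using hpq)
    rw [Matrix.mulVec_add, Matrix.mulVec_smul, Matrix.mulVec_smul, hv, hw] at h1
    have e1 : ∑ k, (p • v + q • w) k * (p • h.eigenvalues i • v + q • h.eigenvalues j • w) k
        = p ^ 2 * h.eigenvalues i * (∑ k, v k * v k) + q ^ 2 * h.eigenvalues j * (∑ k, w k * w k)
          + p * q * (h.eigenvalues i + h.eigenvalues j) * ∑ k, v k * w k := by
      simp only [Finset.mul_sum, ← Finset.sum_add_distrib]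
      apply Finset.sum_congr rfl
      intro k _
      simp
      ring
    have e2 : ∑ k, (p • v + q • w) k ^ 2
        = p ^ 2 * (∑ k, v k * v k) + q ^ 2 * (∑ k, w k * w k) + 2 * p * q * ∑ k, v k * w k := by
      simp only [Finset.mul_sum, ← Finset.sum_add_distrib]
      apply Finset.sum_congr rfl
      intro k _
      simp
      ring
    rw [e1, e2, hvv, hww, hvw] at h1
    linarith
  by_cases h0 : ∑ k, v k = 0
  · have := main 1 0 (by simp [h0])
    linarith
  · have := main (∑ k, w k) (-∑ k, v k) (by ring)
    have hp : 0 < (∑ k, v k) ^ 2 := by positivity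
    nlinarith [sq_nonneg (∑ k, w k), mul_pos hp (sub_pos.mpr hj),
      mul_nonneg (sq_nonneg (∑ k, w k)) (sub_pos.mpr hi).le]

lemma triangle_count {n : ℕ} (G : SimpleGraph (Fin n)) [DecidableRel G.Adj] :
    ∑ v, ∑ u ∈ G.neighborFinset v, ((G.neighborFinset v).filter (G.Adj u)).card
      ≤ 6 * (G.cliqueFinset 3).card := by
  set T : Finset (Fin n × Fin n × Fin n) :=
    Finset.univ.filter (fun p => G.Adj p.1 p.2.1 ∧ G.Adj p.1 p.2.2 ∧ G.Adj p.2.1 p.2.2) with hT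
  have hcard : ∑ v, ∑ u ∈ G.neighborFinset v, ((G.neighborFinset v).filter (G.Adj u)).card
      = T.card := by
    rw [hT, Finset.card_filter, Fintype.sum_prod_type]
    apply Finset.sum_congr rfl
    intro v _
    rw [Fintype.sum_prod_type, SimpleGraph.neighborFinset_eq_filter, Finset.sum_filter]
    apply Finset.sum_congr rfl
    intro u _
    rw [Finset.filter_filter, Finset.card_filter]
    by_cases h : G.Adj v u <;> simp [h]
  rw [hcard]
  refine Finset.card_le_mul_card_image_of_maps_to
    (f := fun p : Fin n × Fin n × Fin n => ({p.1, p.2.1, p.2.2} : Finset (Fin n))) ?_ 6 ?_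
  · rintro ⟨a, b, c⟩ hp
    simp only [hT, Finset.mem_filter, Finset.mem_univ, true_and] at hp
    rw [SimpleGraph.mem_cliqueFinset_iff, SimpleGraph.is3Clique_triple_iff]
    exact hp
  · intro S hS
    rw [SimpleGraph.mem_cliqueFinset_iff, SimpleGraph.is3Clique_iff] at hS
    obtain ⟨x, y, z, hxy, hxz, hyz, rfl⟩ := hS
    refine (Finset.card_le_card (t := {(x, y, z), (x, z, y), (y, x, z), (y, z, x), (z, x, y),
      (z, y, x)}) ?_).trans Finset.card_le_six
    rintro ⟨a, b, c⟩ hp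
    simp only [hT, Finset.mem_filter, Finset.mem_univ, true_and] at hp
    obtain ⟨⟨h1, h2, h3⟩, h4⟩ := hp
    have ha : a ∈ ({x, y, z} : Finset (Fin n)) := by rw [← h4]; simp
    have hb : b ∈ ({x, y, z} : Finset (Fin n)) := by rw [← h4]; simp
    have hc : c ∈ ({x, y, z} : Finset (Fin n)) := by rw [← h4]; simp
    have n1 := h1.ne
    have n2 := h2.ne
    have n3 := h3.ne
    clear h4 h1 h2 h3
    simp only [Finset.mem_insert, Finset.mem_singleton, Prod.mk.injEq] at ha hb hc ⊢
    rcases ha with rfl | rfl | rfl <;> rcases hb with rfl | rfl | rfl <;>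
      rcases hc with rfl | rfl | rfl <;> simp_all

theorem second_largest_distance_eigenvalue_lt_triangles {n s : ℕ}
    (hs : 2 ≤ s) (G : SimpleGraph (Fin n)) [DecidableRel G.Adj]
    (hn : s ^ 3 + s ^ 2 - 2 * s + 1 < n) (hG : G.Connected)
    (hα : IndepNumLE G s) :
    distEig G 2 <
      3 * (s : ℝ) ^ 3 * ((G.cliqueFinset 3).card : ℝ) / (G.edgeFinset.card : ℝ) := by
  have hn' : s ^ 3 + s ^ 2 + 1 < n + 2 * s := by omega
  have h2n : 2 ≤ n := by omega
  have hsn : s < n := by nlinarith [sq_nonneg (s : ℤ), Nat.zero_le (s ^ 3)]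
  have hE := eig_bound G h2n _ (quad_bound G hG hα)
  have hnR : (s : ℝ) ^ 3 + s ^ 2 + 1 < n + 2 * s := by exact_mod_cast hn'
  have hsR : (2 : ℝ) ≤ s := by exact_mod_cast hs
  have hsnR : (s : ℝ) < n := by exact_mod_cast hsn
  have hdeg : (∑ v, (G.degree v : ℝ)) = 2 * (G.edgeFinset.card : ℝ) := by
    exact_mod_cast G.sum_degrees_eq_twice_card_edges
  -- Turán for the whole graph
  have hU := turan_aux G s Finset.univ (fun S _ hS => hα S hS)
  have hU' : (n : ℝ) ^ 2 ≤ s * (2 * (G.edgeFinset.card : ℝ) + n) := by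
    rw [← hdeg]
    simpa [Finset.sum_add_distrib, ← SimpleGraph.neighborFinset_eq_filter] using hU
  -- Turán in the neighbourhoods
  have hN : ∀ v, (G.degree v : ℝ) ^ 2 ≤ s * (((∑ u ∈ G.neighborFinset v,
      ((G.neighborFinset v).filter (G.Adj u)).card : ℕ) : ℝ) + G.degree v) := by
    intro v
    have := turan_aux G s (G.neighborFinset v) (fun S _ hS => hα S hS)
    simpa [Finset.sum_add_distrib] using this
  have hNs := Finset.sum_le_sum (s := Finset.univ) (fun v (_ : v ∈ Finset.univ) => hN v)
  rw [← Finset.mul_sum, Finset.sum_add_distrib, hdeg, ← Nat.cast_sum] at hNs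
  have hT : (((∑ v, ∑ u ∈ G.neighborFinset v,
      ((G.neighborFinset v).filter (G.Adj u)).card : ℕ)) : ℝ) ≤ 6 * ((G.cliqueFinset 3).card : ℝ) := by
    exact_mod_cast triangle_count G
  have hCS := sq_sum_le_card_mul_sum_sq (s := (Finset.univ : Finset (Fin n)))
    (f := fun v => (G.degree v : ℝ))
  rw [hdeg, Finset.card_univ, Fintype.card_fin] at hCS
  set m : ℝ := (G.edgeFinset.card : ℝ)
  set t : ℝ := ((G.cliqueFinset 3).card : ℝ)
  have hn0 : (0 : ℝ) < n := by linarith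
  have hs0 : (0 : ℝ) < s := by linarith
  have hm : 0 < m := by
    have h1 : (n : ℝ) * (n - s) ≤ s * (2 * m) := by nlinarith
    have h2 : 0 < (n : ℝ) * (n - s) := mul_pos hn0 (by linarith)
    have h3 : 0 < s * (2 * m) := lt_of_lt_of_le h2 h1
    have := pos_of_mul_pos_right h3 hs0.le
    linarith
  have hB : (2 * m) ^ 2 ≤ n * (s * (6 * t + 2 * m)) := by
    refine hCS.trans (mul_le_mul_of_nonneg_left (hNs.trans ?_) hn0.le)
    exact mul_le_mul_of_nonneg_left (by linarith) hs0.le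
  refine lt_of_le_of_lt hE ?_
  have hlt : ((s : ℝ) - 1) * n - (2 * s - 1) < s * n - s ^ 2 - s ^ 3 := by linarith
  refine lt_of_lt_of_le hlt ?_
  rw [le_div_iff₀ hm]
  -- 2 m s ≥ n (n - s)
  have h1 : (n : ℝ) * (n - s) ≤ s * (2 * m) := by nlinarith
  have h2 : (s : ℝ) * m * (n * (n - s)) ≤ s * m * (s * (2 * m)) :=
    mul_le_mul_of_nonneg_left h1 (by positivity)
  have h3 : (s : ℝ) ^ 2 * (2 * m) ^ 2 ≤ s ^ 2 * (n * (s * (6 * t + 2 * m))) :=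
    mul_le_mul_of_nonneg_left hB (by positivity)
  have h4 : (n : ℝ) * ((s * n - s ^ 2 - s ^ 3) * m) ≤ n * (3 * s ^ 3 * t) := by nlinarith
  exact le_of_mul_le_mul_left h4 hn0
end
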